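/- Let S₁,…,S₆ ⊂ ℂ be finite constellations, each with nonzero Coordinate Product Distance. Then the set of θ ∈ [0, 2π] for which there exist tuples x = (x¹,…,x⁶) ≠ y = (y¹,…,y⁶) with xᵏ, yᵏ ∈ Sₖ for all k such that the 3×4 matrix X'(θ; x) − X'(θ; y) has rank strictly less than 3, is a finite set. Consequently, if θ is chosen uniformly at random from [0, 2π], then with probability one every difference matrix X'(θ; x) − X'(θ; y) with x ≠ y has rank 3. -/

import Mathlib

open Complex Matrix

/-- The proposed 3×4 STBC `X'(θ; x¹,…,x⁶)` for three transmit antennas.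
Symbols are indexed `x 0, …, x 5` corresponding to `x¹, …, x⁶`. -/
noncomputable def Xc (θ : ℝ) (x : Fin 6 → ℂ) : Matrix (Fin 3) (Fin 4) ℂ :=
  ![![((x 0).re : ℂ) + ((x 2).im : ℂ) * I,
     -((x 1).re : ℂ) + ((x 3).im : ℂ) * I,
     exp (θ * I) * (((x 4).re : ℂ) + ((x 5).im : ℂ) * I),
     exp (θ * I) * (-((x 2).re : ℂ) + ((x 0).im : ℂ) * I)],
    ![((x 1).re : ℂ) + ((x 3).im : ℂ) * I,
     ((x 0).re : ℂ) - ((x 2).im : ℂ) * I,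
     exp (θ * I) * (((x 3).re : ℂ) + ((x 1).im : ℂ) * I),
     exp (θ * I) * (((x 4).re : ℂ) - ((x 5).im : ℂ) * I)],
    ![exp (θ * I) * (((x 5).re : ℂ) + ((x 4).im : ℂ) * I),
     exp (θ * I) * (-((x 5).re : ℂ) + ((x 4).im : ℂ) * I),
     ((x 2).re : ℂ) + ((x 0).im : ℂ) * I,
     -((x 3).re : ℂ) + ((x 1).im : ℂ) * I]]

/-- A finite constellation `S ⊆ ℂ` has nonzero Coordinate Product Distance. -/
def HasNonzeroCPD (S : Set ℂ) : Prop :=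
  ∀ u ∈ S, ∀ v ∈ S, u ≠ v → (u.re - v.re) * (u.im - v.im) ≠ 0

theorem xc_sub (θ : ℝ) (x y : Fin 6 → ℂ) : Xc θ x - Xc θ y = Xc θ (x - y) := by
  ext i j
  rw [Matrix.sub_apply]
  fin_cases i <;> fin_cases j <;> simp [Xc] <;> ring

theorem det_eq_zero_of_rank_lt (M : Matrix (Fin 3) (Fin 4) ℂ) (h : M.rank < 3)
    (f : Fin 3 → Fin 4) : (M.submatrix id f).det = 0 := by
  by_contra hne
  have h1 : (M.submatrix id f).rank = 3 := by
    have := Matrix.rank_of_isUnit (M.submatrix id f)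
      ((Matrix.isUnit_iff_isUnit_det _).2 (isUnit_iff_ne_zero.2 hne))
    simpa using this
  have h2 : (M.submatrix id f).rank ≤ M.rank := Matrix.rank_submatrix_le M id f
  omega

theorem finite_theta (T : Set ℂ) (hT : T.Finite) :
    {θ ∈ Set.Icc (0 : ℝ) (2 * Real.pi) | exp (θ * I) ∈ T}.Finite := by
  have hinj : Set.InjOn (fun θ : ℝ => exp (θ * I)) (Set.Ico 0 (2 * Real.pi)) := by
    intro a ha b hb hab
    obtain ⟨n, hn⟩ := Complex.exp_eq_exp_iff_exists_int.1 hab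
    have h : a = b + n * (2 * Real.pi) := by
      have := congrArg Complex.im hn
      simpa using this
    have hpi := Real.pi_pos
    have h1 : (n : ℝ) < 1 := by
      by_contra hc
      push Not at hc
      nlinarith [ha.2, hb.1]
    have h2 : (-1 : ℝ) < n := by
      by_contra hc
      push Not at hc
      nlinarith [ha.1, hb.2]
    have h3 : n = 0 := by
      have h1' : n < 1 := by exact_mod_cast h1
      have h2' : -1 < n := by exact_mod_cast h2
      omega
    rw [h, h3]; simp
  have hfin : (Set.Ico (0 : ℝ) (2 * Real.pi) ∩ (fun θ : ℝ => exp (θ * I)) ⁻¹' T).Finite := by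
    apply Set.Finite.of_finite_image (f := fun θ : ℝ => exp (θ * I))
    · apply hT.subset
      rintro _ ⟨t, ht, rfl⟩
      exact ht.2
    · exact hinj.mono Set.inter_subset_left
  apply (hfin.union (Set.finite_singleton (2 * Real.pi))).subset
  rintro t ⟨ht, htT⟩
  rcases ht.2.lt_or_eq with h | h
  · exact Or.inl ⟨⟨ht.1, h⟩, htT⟩
  · exact Or.inr h

theorem finite_quad (c q : ℂ) (hc : c ≠ 0) : {z : ℂ | c + q * z ^ 2 = 0}.Finite := by
  by_cases he : ∃ w, c + q * w ^ 2 = 0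
  · obtain ⟨w, hw⟩ := he
    apply (Set.toFinite {w, -w}).subset
    intro z hz
    have hz' : c + q * z ^ 2 = 0 := hz
    have hq : q ≠ 0 := by
      rintro rfl
      simp at hw
      exact hc hw
    have h : q * (z ^ 2 - w ^ 2) = 0 := by linear_combination hz' - hw
    have h2 : z ^ 2 = w ^ 2 := sub_eq_zero.1 ((mul_eq_zero.1 h).resolve_left hq)
    simpa using sq_eq_sq_iff_eq_or_eq_neg.1 h2
  · push Not at he
    convert Set.finite_empty
    ext z
    simp [he z]

theorem finite_of_det (d : Fin 6 → ℂ) (f : Fin 3 → Fin 4) (c q : ℂ) (hc : c ≠ 0)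
    (h : ∀ θ : ℝ, ((Xc θ d).submatrix id f).det = c + q * exp (θ * I) ^ 2) :
    {θ ∈ Set.Icc (0 : ℝ) (2 * Real.pi) | (Xc θ d).rank < 3}.Finite := by
  apply (finite_theta _ (finite_quad c q hc)).subset
  rintro t ⟨ht, hr⟩
  refine ⟨ht, ?_⟩
  have := det_eq_zero_of_rank_lt _ hr f
  rw [h] at this
  exact this

theorem det_three (d : Fin 6 → ℂ) : ∃ q : ℂ, ∀ θ : ℝ,
    ((Xc θ d).submatrix id ![0, 1, 2]).det =
      (((d 2).re : ℂ) + ((d 0).im : ℂ) * I) *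
        (((d 0).re ^ 2 + (d 2).im ^ 2 + (d 1).re ^ 2 + (d 3).im ^ 2 : ℝ) : ℂ)
      + q * exp (θ * I) ^ 2 := by
  refine ⟨((d 5).re + (d 4).im * I) * ((-(d 1).re + (d 3).im * I) * ((d 3).re + (d 1).im * I)
      - ((d 4).re + (d 5).im * I) * ((d 0).re - (d 2).im * I))
    - (-(d 5).re + (d 4).im * I) * (((d 0).re + (d 2).im * I) * ((d 3).re + (d 1).im * I)
      - ((d 4).re + (d 5).im * I) * ((d 1).re + (d 3).im * I)), fun θ => ?_⟩
  simp only [Matrix.det_fin_three, Matrix.submatrix_apply, id]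
  simp [Xc]
  linear_combination (-((d 2).re + (d 0).im * I) * ((d 2).im ^ 2 + (d 3).im ^ 2) : ℂ) * I_sq

theorem det_four (d : Fin 6 → ℂ) : ∃ q : ℂ, ∀ θ : ℝ,
    ((Xc θ d).submatrix id ![0, 1, 3]).det =
      (-((d 3).re : ℂ) + ((d 1).im : ℂ) * I) *
        (((d 0).re ^ 2 + (d 2).im ^ 2 + (d 1).re ^ 2 + (d 3).im ^ 2 : ℝ) : ℂ)
      + q * exp (θ * I) ^ 2 := by
  refine ⟨((d 5).re + (d 4).im * I) * ((-(d 1).re + (d 3).im * I) * ((d 4).re - (d 5).im * I)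
      - (-(d 2).re + (d 0).im * I) * ((d 0).re - (d 2).im * I))
    - (-(d 5).re + (d 4).im * I) * (((d 0).re + (d 2).im * I) * ((d 4).re - (d 5).im * I)
      - (-(d 2).re + (d 0).im * I) * ((d 1).re + (d 3).im * I)), fun θ => ?_⟩
  simp only [Matrix.det_fin_three, Matrix.submatrix_apply, id]
  simp [Xc]
  linear_combination (-(-(d 3).re + (d 1).im * I) * ((d 2).im ^ 2 + (d 3).im ^ 2) : ℂ) * I_sq

theorem ne_zero_of_parts (a b : ℝ) (h : a ≠ 0 ∨ b ≠ 0) : (a : ℂ) + (b : ℂ) * I ≠ 0 := by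
  intro h0
  have h1 := congrArg Complex.re h0
  have h2 := congrArg Complex.im h0
  simp at h1 h2
  tauto

theorem finite_single (d : Fin 6 → ℂ) (hd : ∀ k, d k = 0 ∨ ((d k).re ≠ 0 ∧ (d k).im ≠ 0))
    (hne : d ≠ 0) :
    {θ ∈ Set.Icc (0 : ℝ) (2 * Real.pi) | (Xc θ d).rank < 3}.Finite := by
  by_cases h02 : d 0 ≠ 0 ∨ d 2 ≠ 0
  · obtain ⟨q, hq⟩ := det_three d
    refine finite_of_det d _ _ q (mul_ne_zero (ne_zero_of_parts _ _ ?_) ?_) hq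
    · rcases h02 with h | h
      · exact Or.inr ((hd 0).resolve_left h).2
      · exact Or.inl ((hd 2).resolve_left h).1
    · refine Complex.ofReal_ne_zero.2 (ne_of_gt ?_)
      rcases h02 with h | h
      · have := ((hd 0).resolve_left h).1
        positivity
      · have := ((hd 2).resolve_left h).2
        positivity
  by_cases h13 : d 1 ≠ 0 ∨ d 3 ≠ 0
  · obtain ⟨q, hq⟩ := det_four d
    refine finite_of_det d _ _ q (mul_ne_zero ?_ ?_) hq
    · rw [← Complex.ofReal_neg]
      apply ne_zero_of_parts
      rcases h13 with h | h
      · exact Or.inr ((hd 1).resolve_left h).2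
      · exact Or.inl (neg_ne_zero.2 ((hd 3).resolve_left h).1)
    · refine Complex.ofReal_ne_zero.2 (ne_of_gt ?_)
      rcases h13 with h | h
      · have := ((hd 1).resolve_left h).1
        positivity
      · have := ((hd 3).resolve_left h).2
        positivity
  push Not at h02 h13
  obtain ⟨h0, h2⟩ := h02
  obtain ⟨h1, h3⟩ := h13
  have h45 : d 4 ≠ 0 ∨ d 5 ≠ 0 := by
    by_contra hc
    push Not at hc
    apply hne
    funext k
    fin_cases k
    exacts [h0, h1, h2, h3, hc.1, hc.2]
  convert Set.finite_empty
  ext t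
  simp only [Set.mem_setOf_eq, Set.mem_empty_iff_false, iff_false, not_and]
  intro _ hr
  have hdet := det_eq_zero_of_rank_lt _ hr ![0, 2, 3]
  have key : ((Xc t d).submatrix id ![0, 2, 3]).det = exp (t * I) ^ 3 *
      (((d 5).re : ℂ) + ((d 4).im : ℂ) * I) * (((d 4).re ^ 2 + (d 5).im ^ 2 : ℝ) : ℂ) := by
    simp only [Matrix.det_fin_three, Matrix.submatrix_apply, id]
    simp [Xc, h0, h1, h2, h3]
    linear_combination
      (-exp (t * I) ^ 3 * ((d 5).re + (d 4).im * I) * (d 5).im ^ 2 : ℂ) * I_sq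
  rw [key] at hdet
  refine mul_ne_zero (mul_ne_zero (pow_ne_zero _ (Complex.exp_ne_zero _))
    (ne_zero_of_parts _ _ ?_)) (Complex.ofReal_ne_zero.2 (ne_of_gt ?_)) hdet
  · rcases h45 with h | h
    · exact Or.inr ((hd 4).resolve_left h).2
    · exact Or.inl ((hd 5).resolve_left h).1
  · rcases h45 with h | h
    · have := ((hd 4).resolve_left h).1
      positivity
    · have := ((hd 5).resolve_left h).2
      positivity

open MeasureTheory in
/-- The set of `θ ∈ [0, 2π]` for which some difference matrix of the proposed
STBC fails to have rank 3 is finite; consequently, choosing `θ` uniformly at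
random from `[0, 2π]`, almost surely every difference matrix has rank 3. -/
theorem bad_theta_finite_and_ae_rank_three (S : Fin 6 → Set ℂ)
    (hfin : ∀ k, (S k).Finite) (hcpd : ∀ k, HasNonzeroCPD (S k)) :
    {θ ∈ Set.Icc (0 : ℝ) (2 * Real.pi) |
      ∃ x y : Fin 6 → ℂ, (∀ k, x k ∈ S k) ∧ (∀ k, y k ∈ S k) ∧ x ≠ y ∧
        (Xc θ x - Xc θ y).rank < 3}.Finite ∧
    ∀ᵐ θ ∂(volume.restrict (Set.Icc (0 : ℝ) (2 * Real.pi))),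
      ∀ x y : Fin 6 → ℂ, (∀ k, x k ∈ S k) → (∀ k, y k ∈ S k) → x ≠ y →
        (Xc θ x - Xc θ y).rank = 3 := by
  have hF : {θ ∈ Set.Icc (0 : ℝ) (2 * Real.pi) |
      ∃ x y : Fin 6 → ℂ, (∀ k, x k ∈ S k) ∧ (∀ k, y k ∈ S k) ∧ x ≠ y ∧
        (Xc θ x - Xc θ y).rank < 3}.Finite := by
    have hpi : (Set.univ.pi S).Finite := Set.Finite.pi hfin
    have hP : ((Set.univ.pi S) ×ˢ (Set.univ.pi S) ∩ {p | p.1 ≠ p.2}).Finite :=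
      (hpi.prod hpi).subset Set.inter_subset_left
    refine (hP.biUnion (t := fun p => {θ ∈ Set.Icc (0 : ℝ) (2 * Real.pi) |
      (Xc θ (p.1 - p.2)).rank < 3}) ?_).subset ?_
    · rintro ⟨x, y⟩ ⟨⟨hx, hy⟩, hxy⟩
      refine finite_single _ (fun k => ?_) (sub_ne_zero.2 hxy)
      by_cases hk : x k = y k
      · exact Or.inl (by simp [hk])
      · right
        have := hcpd k (x k) (hx k trivial) (y k) (hy k trivial) hk
        simpa using mul_ne_zero_iff.1 this
    · rintro t ⟨ht, x, y, hx, hy, hxy, hr⟩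
      rw [xc_sub] at hr
      exact Set.mem_biUnion (x := (x, y)) ⟨⟨fun k _ => hx k, fun k _ => hy k⟩, hxy⟩ ⟨ht, hr⟩
  refine ⟨hF, ?_⟩
  rw [ae_restrict_iff' measurableSet_Icc]
  filter_upwards [compl_mem_ae_iff.2 (hF.measure_zero volume)] with t ht htI x y hx hy hxy
  by_contra hr
  apply ht
  refine ⟨htI, x, y, hx, hy, hxy, lt_of_le_of_ne ?_ hr⟩
  simpa using Matrix.rank_le_height (Xc t x - Xc t y)
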